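/- Under the Hölder-like condition, for any starting point x₀ ∈ B(x*, r) with x₀ ≠ x*, the Newton sequence x_{k+1} = x_k − F'(x_k)^{-1} F(x_k) is well defined, is contained in B(x*, r), and converges to x*; moreover, setting t₀ = ‖x₀ − x*‖, the scalar sequence t_{k+1} = K p t_k^{p+1} / ((p+1)(1 − K t_k^p)) is strictly decreasing, contained in (0, r), and converges to 0. -/

import Mathlib

open Filter Metric Set Topology

/-- The contraction factor of the Newton majorant `t ↦ newtonFactor K p t * t`. -/
noncomputable def newtonFactor (K p t : ℝ) : ℝ :=
  K * p * t ^ p / ((p + 1) * (1 - K * t ^ p))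

section Scalar

variable {K p s t : ℝ}

theorem mul_rpow_lt_of_lt_rpow (hK : 0 < K) (hp : 0 < p) (ht : 0 ≤ t)
    (h : t < ((p + 1) / ((2 * p + 1) * K)) ^ (1 / p)) : K * t ^ p * (2 * p + 1) < p + 1 := by
  have hA : 0 ≤ (p + 1) / ((2 * p + 1) * K) := by positivity
  rw [one_div, Real.lt_rpow_inv_iff_of_pos ht hA hp, lt_div_iff₀ (by positivity)] at h
  linarith

theorem mul_rpow_lt_one (hp : 0 < p) (h : K * t ^ p * (2 * p + 1) < p + 1) : K * t ^ p < 1 := by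
  by_contra! h'
  nlinarith

theorem newtonFactor_nonneg (hK : 0 < K) (hp : 0 < p) (ht : 0 ≤ t)
    (h : K * t ^ p * (2 * p + 1) < p + 1) : 0 ≤ newtonFactor K p t := by
  have := sub_pos.2 (mul_rpow_lt_one hp h)
  unfold newtonFactor
  positivity

theorem newtonFactor_pos (hK : 0 < K) (hp : 0 < p) (ht : 0 < t)
    (h : K * t ^ p * (2 * p + 1) < p + 1) : 0 < newtonFactor K p t := by
  have := sub_pos.2 (mul_rpow_lt_one hp h)
  unfold newtonFactor
  positivity

theorem newtonFactor_lt_one (hp : 0 < p) (h : K * t ^ p * (2 * p + 1) < p + 1) :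
    newtonFactor K p t < 1 := by
  have := sub_pos.2 (mul_rpow_lt_one hp h)
  rw [newtonFactor, div_lt_one (by positivity)]
  linarith

theorem newtonFactor_mono (hK : 0 < K) (hp : 0 < p) (hs : 0 ≤ s) (hst : s ≤ t)
    (h : K * t ^ p * (2 * p + 1) < p + 1) : newtonFactor K p s ≤ newtonFactor K p t := by
  have := sub_pos.2 (mul_rpow_lt_one hp h)
  have ht := hs.trans hst
  unfold newtonFactor
  gcongr

theorem newtonFactor_mul_self (ht : 0 < t) :
    newtonFactor K p t * t = K * p * t ^ (p + 1) / ((p + 1) * (1 - K * t ^ p)) := by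
  rw [newtonFactor, Real.rpow_add_one ht.ne']
  ring

theorem le_newtonFactor_pow_mul {a : ℕ → ℝ} (hK : 0 < K) (hp : 0 < p) (ha : ∀ k, 0 ≤ a k)
    (h : K * a 0 ^ p * (2 * p + 1) < p + 1)
    (hstep : ∀ k, a k ≤ a 0 → a (k + 1) ≤ newtonFactor K p (a k) * a k) (k : ℕ) :
    a k ≤ newtonFactor K p (a 0) ^ k * a 0 := by
  have hq0 := newtonFactor_nonneg hK hp (ha 0) h
  have hq1 := (newtonFactor_lt_one hp h).le
  induction k with
  | zero => simp
  | succ k ih =>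
    have hk : a k ≤ a 0 := ih.trans (mul_le_of_le_one_left (ha 0) (pow_le_one₀ hq0 hq1))
    calc a (k + 1) ≤ newtonFactor K p (a k) * a k := hstep k hk
      _ ≤ newtonFactor K p (a 0) * (newtonFactor K p (a 0) ^ k * a 0) :=
        mul_le_mul (newtonFactor_mono hK hp (ha k) hk h) ih (ha k) hq0
      _ = _ := by ring

theorem le_initial_and_tendsto_of_le_newtonFactor_mul {a : ℕ → ℝ} (hK : 0 < K) (hp : 0 < p)
    (ha : ∀ k, 0 ≤ a k) (h : K * a 0 ^ p * (2 * p + 1) < p + 1)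
    (hstep : ∀ k, a k ≤ a 0 → a (k + 1) ≤ newtonFactor K p (a k) * a k) :
    (∀ k, a k ≤ a 0) ∧ Tendsto a atTop (𝓝 0) := by
  have hq0 := newtonFactor_nonneg hK hp (ha 0) h
  have hq1 := newtonFactor_lt_one hp h
  have hle := le_newtonFactor_pow_mul hK hp ha h hstep
  refine ⟨fun k ↦ (hle k).trans (mul_le_of_le_one_left (ha 0) (pow_le_one₀ hq0 hq1.le)),
    squeeze_zero ha hle ?_⟩
  simpa using (tendsto_pow_atTop_nhds_zero_of_lt_one hq0 hq1).mul_const (a 0)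

theorem strictAnti_and_tendsto_of_newton_recurrence {t : ℕ → ℝ} (hK : 0 < K) (hp : 0 < p)
    (ht : 0 < t 0) (h : K * t 0 ^ p * (2 * p + 1) < p + 1)
    (hrec : ∀ k, t (k + 1) = K * p * t k ^ (p + 1) / ((p + 1) * (1 - K * t k ^ p))) :
    StrictAnti t ∧ (∀ k, 0 < t k) ∧ Tendsto t atTop (𝓝 0) := by
  have hcond {u : ℝ} (hu : 0 < u) (hu' : u ≤ t 0) : K * u ^ p * (2 * p + 1) < p + 1 :=
    lt_of_le_of_lt (by gcongr) h
  have hnext {k : ℕ} (hk : 0 < t k) : t (k + 1) = newtonFactor K p (t k) * t k := by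
    rw [hrec, newtonFactor_mul_self hk]
  have hlt {k : ℕ} (hk : 0 < t k) (hk' : t k ≤ t 0) : t (k + 1) < t k := by
    rw [hnext hk]
    exact mul_lt_of_lt_one_left hk (newtonFactor_lt_one hp (hcond hk hk'))
  have hbd (k : ℕ) : 0 < t k ∧ t k ≤ t 0 := by
    induction k with
    | zero => exact ⟨ht, le_rfl⟩
    | succ k ih =>
      refine ⟨?_, (hlt ih.1 ih.2).le.trans ih.2⟩
      rw [hnext ih.1]
      exact mul_pos (newtonFactor_pos hK hp ih.1 (hcond ih.1 ih.2)) ih.1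
  exact ⟨strictAnti_nat_of_succ_lt fun k ↦ hlt (hbd k).1 (hbd k).2, fun k ↦ (hbd k).1,
    (le_initial_and_tendsto_of_le_newtonFactor_mul hK hp (fun k ↦ (hbd k).1.le) h
      fun k _ ↦ (hnext (hbd k).1).le).2⟩

end Scalar

theorem Metric.ball_sSup_subset {X : Type*} [PseudoMetricSpace X] {x : X} {Ω : Set X} {R : ℝ}
    (hR : 0 < R) : ball x (sSup {t | t ∈ Ico 0 R ∧ ball x t ⊆ Ω}) ⊆ Ω := by
  intro y hy
  obtain ⟨t, ht, hyt⟩ := exists_lt_of_lt_csSup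
    (s := {t | t ∈ Ico 0 R ∧ ball x t ⊆ Ω}) ⟨0, ⟨le_rfl, hR⟩, by simp⟩ (mem_ball.1 hy)
  exact ht.2 hyt

section Newton

variable {X Y : Type*} [NormedAddCommGroup X] [NormedSpace ℝ X]
  [NormedAddCommGroup Y] [NormedSpace ℝ Y]

theorem norm_linearization_error_le {F : X → Y} {F' : X → X →L[ℝ] Y} {B : Y →L[ℝ] X}
    {xs x : X} {K p : ℝ} (hp : 0 < p) (hFxs : F xs = 0)
    (hF : ∀ τ ∈ Icc (0 : ℝ) 1, HasFDerivAt F (F' (xs + τ • (x - xs))) (xs + τ • (x - xs)))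
    (hHol : ∀ τ ∈ Icc (0 : ℝ) 1,
      ‖B.comp (F' x - F' (xs + τ • (x - xs)))‖ ≤ K * (1 - τ ^ p) * ‖x - xs‖ ^ p) :
    ‖B (F' x (x - xs) - F x)‖ ≤ K * p / (p + 1) * ‖x - xs‖ ^ p * ‖x - xs‖ := by
  set v := x - xs with hv
  have hφ (τ : ℝ) (hτ : τ ∈ Icc (0 : ℝ) 1) :
      HasDerivAt (fun τ : ℝ ↦ B (τ • F' x v - F (xs + τ • v)))
        (B (F' x v - F' (xs + τ • v) v)) τ := by
    have hline : HasDerivAt (fun τ : ℝ ↦ xs + τ • v) v τ := by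
      simpa using ((hasDerivAt_id τ).smul_const v).const_add xs
    have hlin : HasDerivAt (fun τ : ℝ ↦ τ • F' x v) (F' x v) τ := by
      simpa using (hasDerivAt_id τ).smul_const (F' x v)
    exact B.hasFDerivAt.comp_hasDerivAt τ (hlin.sub ((hF τ hτ).comp_hasDerivAt τ hline))
  have hbound (τ : ℝ) :
      HasDerivAt (fun τ : ℝ ↦ K * ‖v‖ ^ p * ‖v‖ * (τ - τ ^ (p + 1) / (p + 1)))
        (K * ‖v‖ ^ p * ‖v‖ * (1 - τ ^ p)) τ := by
    have hpow := (Real.hasDerivAt_rpow_const (x := τ) (p := p + 1)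
      (Or.inr (by linarith))).div_const (p + 1)
    rw [add_sub_cancel_right, mul_div_cancel_left₀ _ (by positivity)] at hpow
    exact ((hasDerivAt_id τ).sub hpow).const_mul _
  have key := image_norm_le_of_norm_deriv_right_le_deriv_boundary
    (fun τ hτ ↦ (hφ τ hτ).continuousAt.continuousWithinAt)
    (fun τ hτ ↦ (hφ τ (Ico_subset_Icc_self hτ)).hasDerivWithinAt)
    (by simp [hFxs, Real.zero_rpow (by positivity : p + 1 ≠ 0)]) hbound
    (fun τ hτ ↦ by
      have h := (B.comp (F' x - F' (xs + τ • v))).le_of_opNorm_le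
        (hHol τ (Ico_subset_Icc_self hτ)) v
      simp only [ContinuousLinearMap.comp_apply, sub_apply] at h
      linarith) (right_mem_Icc.2 zero_le_one)
  simp only [one_smul, Real.one_rpow, hv, add_sub_cancel] at key
  refine key.trans_eq ?_
  field_simp
  ring

theorem exists_inverse_of_norm_comp_sub_lt_one [CompleteSpace X] {L L₀ : X →L[ℝ] Y}
    {B : Y →L[ℝ] X} (hB1 : B.comp L₀ = ContinuousLinearMap.id ℝ X)
    (hB2 : L₀.comp B = ContinuousLinearMap.id ℝ Y) {c : ℝ} (hc : c < 1)
    (hL : ‖B.comp (L - L₀)‖ ≤ c) :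
    ∃ G : Y →L[ℝ] X, G.comp L = ContinuousLinearMap.id ℝ X ∧
      L.comp G = ContinuousLinearMap.id ℝ Y ∧ ∀ y, ‖G y‖ ≤ ‖B y‖ / (1 - c) := by
  have hsub : B.comp (L - L₀) = B.comp L - 1 := by
    rw [ContinuousLinearMap.comp_sub, hB1]; rfl
  rw [hsub] at hL
  obtain ⟨u, hu⟩ : IsUnit (B.comp L) := by
    have := isUnit_one_sub_of_norm_lt_one (x := 1 - B.comp L)
      (by rw [norm_sub_rev]; exact hL.trans_lt hc)
    simpa using this
  have hBL₀ (y : Y) : L₀ (B y) = y := DFunLike.congr_fun hB2 y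
  have huv (w : X) : B (L ((↑u⁻¹ : X →L[ℝ] X) w)) = w := by
    have := DFunLike.congr_fun u.mul_inv w
    rwa [hu] at this
  have hvu (w : X) : (↑u⁻¹ : X →L[ℝ] X) (B (L w)) = w := by
    have := DFunLike.congr_fun u.inv_mul w
    rwa [hu] at this
  refine ⟨(↑u⁻¹ : X →L[ℝ] X).comp B, ContinuousLinearMap.ext hvu, ?_, fun y ↦ ?_⟩
  · ext y
    simp only [ContinuousLinearMap.comp_apply, ContinuousLinearMap.id_apply]
    rw [← hBL₀ (L _), huv, hBL₀]
  · rw [le_div_iff₀ (sub_pos.2 hc), ContinuousLinearMap.comp_apply]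
    set w := (↑u⁻¹ : X →L[ℝ] X) (B y)
    have hw : B (L w) = B y := huv (B y)
    have h1 := (B.comp L - 1).le_of_opNorm_le hL w
    simp only [sub_apply, ContinuousLinearMap.comp_apply, hw,
      one_apply_eq_self] at h1
    have h2 := norm_le_norm_add_norm_sub (B y) w
    linarith

theorem exists_newton_step [CompleteSpace X] {F : X → Y} {F' : X → X →L[ℝ] Y} {B : Y →L[ℝ] X}
    {xs x : X} {K p : ℝ} (hp : 0 < p) (hFxs : F xs = 0)
    (hB1 : B.comp (F' xs) = ContinuousLinearMap.id ℝ X)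
    (hB2 : (F' xs).comp B = ContinuousLinearMap.id ℝ Y)
    (hF : ∀ τ ∈ Icc (0 : ℝ) 1, HasFDerivAt F (F' (xs + τ • (x - xs))) (xs + τ • (x - xs)))
    (hHol : ∀ τ ∈ Icc (0 : ℝ) 1,
      ‖B.comp (F' x - F' (xs + τ • (x - xs)))‖ ≤ K * (1 - τ ^ p) * ‖x - xs‖ ^ p)
    (h : K * ‖x - xs‖ ^ p < 1) :
    ∃ G : Y →L[ℝ] X, G.comp (F' x) = ContinuousLinearMap.id ℝ X ∧
      (F' x).comp G = ContinuousLinearMap.id ℝ Y ∧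
      ‖x - G (F x) - xs‖ ≤ newtonFactor K p ‖x - xs‖ * ‖x - xs‖ := by
  obtain ⟨G, hG1, hG2, hG⟩ := exists_inverse_of_norm_comp_sub_lt_one hB1 hB2 h
    (by simpa [Real.zero_rpow hp.ne'] using hHol 0 (left_mem_Icc.2 zero_le_one))
  refine ⟨G, hG1, hG2, ?_⟩
  have hGx : G (F' x (x - xs)) = x - xs := DFunLike.congr_fun hG1 _
  have hpos := sub_pos.2 h
  calc ‖x - G (F x) - xs‖ = ‖G (F' x (x - xs) - F x)‖ := by
        rw [map_sub, hGx, sub_right_comm]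
    _ ≤ ‖B (F' x (x - xs) - F x)‖ / (1 - K * ‖x - xs‖ ^ p) := hG _
    _ ≤ K * p / (p + 1) * ‖x - xs‖ ^ p * ‖x - xs‖ / (1 - K * ‖x - xs‖ ^ p) := by
        gcongr
        exact norm_linearization_error_le hp hFxs hF hHol
    _ = _ := by
        rw [newtonFactor]
        field_simp

end Newton

theorem stmt13
    {X Y : Type*} [NormedAddCommGroup X] [NormedSpace ℝ X] [CompleteSpace X]
    [NormedAddCommGroup Y] [NormedSpace ℝ Y] [CompleteSpace Y]
    (Ω : Set X) (hΩ : IsOpen Ω)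
    (F : X → Y) (F' : X → X →L[ℝ] Y)
    (hF : ∀ x ∈ Ω, HasFDerivAt F (F' x) x)
    (hF'c : ContinuousOn F' Ω)
    (xs : X) (hxs : xs ∈ Ω) (hFxs : F xs = 0)
    (B : Y →L[ℝ] X)
    (hB1 : B.comp (F' xs) = ContinuousLinearMap.id ℝ X)
    (hB2 : (F' xs).comp B = ContinuousLinearMap.id ℝ Y)
    (R : ℝ) (hR : 0 < R)
    (κ : ℝ) (hκ : κ = sSup {t | t ∈ Ico 0 R ∧ ball xs t ⊆ Ω})
    (K p : ℝ) (hK : 0 < K) (hp0 : 0 < p) (hp1 : p ≤ 1)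
    (hHol : ∀ x ∈ ball xs κ, ∀ τ ∈ Icc (0:ℝ) 1,
      ‖B.comp (F' x - F' (xs + τ • (x - xs)))‖ ≤ K * (1 - τ ^ p) * ‖x - xs‖ ^ p)
    (r : ℝ) (hr : r = min κ (((p+1) / ((2*p+1) * K)) ^ (1/p)))
    : ∀ x₀ ∈ ball xs r, x₀ ≠ xs →
      (∃ x : ℕ → X, x 0 = x₀ ∧
        (∀ k, ∃ G : Y →L[ℝ] X, G.comp (F' (x k)) = ContinuousLinearMap.id ℝ X ∧
          (F' (x k)).comp G = ContinuousLinearMap.id ℝ Y ∧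
          x (k+1) = x k - G (F (x k))) ∧
        (∀ k, x k ∈ ball xs r) ∧
        Tendsto x atTop (𝓝 xs)) ∧
      (∀ t : ℕ → ℝ, t 0 = ‖x₀ - xs‖ →
        (∀ k, t (k+1) = K * p * t k ^ (p+1) / ((p+1) * (1 - K * t k ^ p))) →
        StrictAnti t ∧ (∀ k, t k ∈ Ioo 0 r) ∧ Tendsto t atTop (𝓝 0)) := by
  subst hr
  have hball : ball xs κ ⊆ Ω := hκ ▸ ball_sSup_subset hR
  intro x₀ hx₀ hne
  set r := min κ (((p+1) / ((2*p+1) * K)) ^ (1/p))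
  have hcond (x : X) (hx : x ∈ ball xs r) : K * ‖x - xs‖ ^ p * (2 * p + 1) < p + 1 :=
    mul_rpow_lt_of_lt_rpow hK hp0 (norm_nonneg _)
      ((mem_ball_iff_norm.1 hx).trans_le (min_le_right _ _))
  have hstep (x : X) : ∃ G : Y →L[ℝ] X, x ∈ ball xs r →
      G.comp (F' x) = ContinuousLinearMap.id ℝ X ∧
      (F' x).comp G = ContinuousLinearMap.id ℝ Y ∧
      ‖x - G (F x) - xs‖ ≤ newtonFactor K p ‖x - xs‖ * ‖x - xs‖ := by
    by_cases hx : x ∈ ball xs r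
    · have hxκ : x ∈ ball xs κ := ball_subset_ball (min_le_left _ _) hx
      obtain ⟨G, hG⟩ := exists_newton_step hp0 hFxs hB1 hB2
        (fun τ hτ ↦ hF _ (hball ((convex_ball xs κ).add_smul_sub_mem
          (mem_ball_self (pos_of_mem_ball hxκ)) hxκ hτ)))
        (hHol x hxκ) (mul_rpow_lt_one hp0 (hcond x hx))
      exact ⟨G, fun _ ↦ hG⟩
    · exact ⟨0, fun h ↦ absurd h hx⟩
  refine ⟨?_, fun t ht0 hrec ↦ ?_⟩
  · choose G hG using hstep
    set x : ℕ → X := fun k ↦ (fun z ↦ z - G z (F z))^[k] x₀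
    have hsucc (k : ℕ) : x (k + 1) = x k - G (x k) (F (x k)) :=
      Function.iterate_succ_apply' _ _ _
    have hmem (k : ℕ) (hk : ‖x k - xs‖ ≤ ‖x 0 - xs‖) : x k ∈ ball xs r :=
      mem_ball_iff_norm.2 (hk.trans_lt (mem_ball_iff_norm.1 hx₀))
    obtain ⟨hle, hlim⟩ := le_initial_and_tendsto_of_le_newtonFactor_mul
      (a := fun k ↦ ‖x k - xs‖) hK hp0 (fun _ ↦ norm_nonneg _) (hcond x₀ hx₀)
      (fun k hk ↦ by
        simp only [hsucc]
        exact (hG _ (hmem k hk)).2.2)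
    exact ⟨x, rfl, fun k ↦ ⟨G (x k), (hG _ (hmem k (hle k))).1, (hG _ (hmem k (hle k))).2.1,
      hsucc k⟩, fun k ↦ hmem k (hle k), tendsto_iff_norm_sub_tendsto_zero.2 hlim⟩
  · obtain ⟨hanti, hpos, hlim⟩ := strictAnti_and_tendsto_of_newton_recurrence hK hp0
      (by rw [ht0]; exact norm_pos_iff.2 (sub_ne_zero.2 hne)) (by rw [ht0]; exact hcond x₀ hx₀)
      hrec
    refine ⟨hanti, fun k ↦ ⟨hpos k, (hanti.antitone k.zero_le).trans_lt ?_⟩, hlim⟩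
    rw [ht0]
    exact mem_ball_iff_norm.1 hx₀
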